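/- arXiv:2312.00928 — 4 statements merged into one kernel-verified Lean document; each statement's English description precedes it below -/
import Mathlib

section
/- Let P be a path graph and let h be a hatness function such that exactly one vertex of P has hatness 2 and every other vertex has hatness 3. Then the game ⟨P,h⟩ is losing. -/
/-- The hat guessing game `⟨G, h⟩` is *winning*: there exists a strategy (one
deterministic guessing function per vertex, depending only on the colors of the
neighboring vertices) such that for every assignment of hat colors at least one
vertex guesses its own color correctly. -/
def HatGame.Winning {V : Type*} (G : SimpleGraph V) (h : V → ℕ) : Prop :=
  ∃ s : ∀ v : V, (∀ u : V, Fin (h u)) → Fin (h v),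
    (∀ (v : V) (c c' : ∀ u : V, Fin (h u)),
        (∀ u : V, G.Adj v u → c u = c' u) → s v c = s v c') ∧
    ∀ c : ∀ u : V, Fin (h u), ∃ v : V, s v c = c v

/-- The hat guessing number of `G`: the largest `q` such that the game on `G`
where every vertex has hatness `q` is winning. -/
noncomputable def HatGame.number {V : Type*} (G : SimpleGraph V) : ℕ :=
  sSup {q : ℕ | HatGame.Winning G (fun _ => q)}

/-- A cactus graph: a connected graph in which every pair of (distinct) cycles
shares at most one vertex. -/
def SimpleGraph.IsCactus {V : Type*} (G : SimpleGraph V) : Prop :=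
  G.Connected ∧
    ∀ (v w : V) (c₁ : G.Walk v v) (c₂ : G.Walk w w), c₁.IsCycle → c₂.IsCycle →
      {e | e ∈ c₁.edges} ≠ {e | e ∈ c₂.edges} →
      ({x | x ∈ c₁.support} ∩ {x | x ∈ c₂.support} : Set V).Subsingleton

/-- On a one-sided arm of hatness-3 vertices whose inner neighbor has color `y`, all but at most
one color of the first vertex extend to a coloring in which the first `m` vertices guess wrong. -/
theorem exists_arm_coloring (m : ℕ) (g : ℕ → Fin 3 → Fin 3 → Fin 3) (y : Fin 3) :
    ∃ b : Fin 3, ∀ x, x ≠ b → ∃ c : ℕ → Fin 3, c 0 = y ∧ c 1 = x ∧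
      ∀ i < m, g i (c i) (c (i + 2)) ≠ c (i + 1) := by
  induction m generalizing g y with
  | zero => exact ⟨0, fun x _ => ⟨fun i => if i = 0 then y else x, by simp⟩⟩
  | succ m ih =>
    choose b hb using ih fun i => g (i + 1)
    obtain ⟨b₀, hb₀⟩ : ∃ b₀ : Fin 3, ∀ x, x ≠ b₀ → ∃ z, z ≠ b x ∧ g 0 y z ≠ x := by
      by_contra! H
      obtain ⟨x₁, -, h₁⟩ := H 0
      obtain ⟨x₂, hne, h₂⟩ := H x₁
      obtain ⟨z, hz₁, hz₂⟩ : ∃ z : Fin 3, z ≠ b x₁ ∧ z ≠ b x₂ := by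
        generalize b x₁ = p, b x₂ = q
        revert p q
        decide
      exact hne ((h₂ z hz₂).symm.trans (h₁ z hz₁))
    refine ⟨b₀, fun x hx => ?_⟩
    obtain ⟨z, hz, hgz⟩ := hb₀ x hx
    obtain ⟨c, hc₀, hc₁, hc⟩ := hb x z hz
    refine ⟨fun i => Nat.casesOn i y c, rfl, hc₀, fun i hi => ?_⟩
    cases i with
    | zero => simpa [hc₀, hc₁] using hgz
    | succ i => exact hc i (by omega)

/-- On the two-way infinite path with three colors, the vertices at distance at most `m` from `0`
can all be made to guess wrong, with vertex `0` using only its first two colors. -/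
theorem exists_line_coloring (m : ℕ) (g : ℤ → Fin 3 → Fin 3 → Fin 3) :
    ∃ c : ℤ → Fin 3, (c 0).val < 2 ∧
      ∀ i : ℤ, i.natAbs ≤ m → g i (c (i - 1)) (c (i + 1)) ≠ c i := by
  choose r hr using exists_arm_coloring m fun i x z => g (i + 1) x z
  choose l hl using exists_arm_coloring m fun i x z => g (-(i + 1)) z x
  have avoid : ∀ p q : Fin 3, ∃ z, z ≠ p ∧ z ≠ q := by decide
  obtain ⟨x, hx₀, hx₁⟩ := avoid (l 0) (l 1)
  obtain ⟨z, hz₀, hz₁⟩ := avoid (r 0) (r 1)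
  obtain ⟨y, hy, hxy, hzy, hgy⟩ : ∃ y : Fin 3, y.val < 2 ∧ x ≠ l y ∧ z ≠ r y ∧ g 0 x z ≠ y := by
    by_cases h : g 0 x z = 0
    · exact ⟨1, by decide, hx₁, hz₁, by simp [h]⟩
    · exact ⟨0, by decide, hx₀, hz₀, h⟩
  obtain ⟨cl, hl₀, hl₁, hcl⟩ := hl y x hxy
  obtain ⟨cr, hr₀, hr₁, hcr⟩ := hr y z hzy
  let c : ℤ → Fin 3 := fun i => if 0 ≤ i then cr i.toNat else cl (-i).toNat
  have hpos : ∀ k : ℕ, c k = cr k := fun k => by simp [c]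
  have hneg : ∀ k : ℕ, c (-(k : ℤ)) = cl k := fun k => by
    rcases k.eq_zero_or_pos with rfl | hk
    · simp [c, hl₀, hr₀]
    · have : ¬ (0 : ℤ) ≤ -(k : ℤ) := by omega
      simp only [c, if_neg this, neg_neg, Int.toNat_natCast]
  refine ⟨c, ?_, fun i hi => ?_⟩
  · rw [show c 0 = y from (hpos 0).trans hr₀]
    exact hy
  · rcases lt_trichotomy i 0 with h | rfl | h
    · obtain ⟨k, rfl⟩ : ∃ k : ℕ, i = -((k : ℤ) + 1) := ⟨(-i).toNat - 1, by omega⟩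
      have h₁ := hneg k
      have h₂ := hneg (k + 1)
      have h₃ := hneg (k + 2)
      rw [show -((k : ℤ) + 1) - 1 = -((k + 2 : ℕ) : ℤ) by push_cast; ring,
        show -((k : ℤ) + 1) + 1 = -(k : ℤ) by ring, h₁, h₃,
        show c (-((k : ℤ) + 1)) = cl (k + 1) by simpa using h₂]
      exact hcl k (by omega)
    · rw [show c (0 - 1) = x by simpa [hl₁] using hneg 1,
        show c (0 + 1) = z by simpa [hr₁] using hpos 1, show c 0 = y from (hpos 0).trans hr₀]
      exact hgy
    · obtain ⟨k, rfl⟩ : ∃ k : ℕ, i = (k : ℤ) + 1 := ⟨i.toNat - 1, by omega⟩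
      have h₁ := hpos k
      have h₂ := hpos (k + 1)
      have h₃ := hpos (k + 2)
      rw [show (k : ℤ) + 1 - 1 = k by ring,
        show (k : ℤ) + 1 + 1 = ((k + 2 : ℕ) : ℤ) by push_cast; ring, h₁, h₃,
        show c ((k : ℤ) + 1) = cr (k + 1) by simpa using h₂]
      exact hcr k (by omega)

/-- A path in which exactly one vertex has hatness 2 and every other vertex has
hatness 3 is losing. -/
theorem path_one_two_rest_three_losing (n : ℕ) (h : Fin n → ℕ) (a : Fin n)
    (ha : h a = 2) (hother : ∀ x, x ≠ a → h x = 3) :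
    ¬ HatGame.Winning (SimpleGraph.pathGraph n) h := by
  classical
  rintro ⟨s, hs, hwin⟩
  have hpos : ∀ u, 0 < h u := fun u => by
    by_cases hu : u = a
    · simp [hu, ha]
    · simp [hother u hu]
  have hle : ∀ u, h u ≤ 3 := fun u => by
    by_cases hu : u = a
    · simp [hu, ha]
    · simp [hother u hu]
  let col : (Fin n → Fin 3) → ∀ u, Fin (h u) := fun d u => ⟨(d u).val % h u, Nat.mod_lt _ (hpos u)⟩
  let guess : Fin n → Fin 3 → Fin 3 → Fin 3 := fun v x z =>
    Fin.castLE (hle v) (s v (col fun u => if u < v then x else z))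
  obtain ⟨c, hc₀, hc⟩ := exists_line_coloring n fun i x z =>
    if hi : ∃ v : Fin n, (v : ℤ) - a = i then guess hi.choose x z else 0
  let d : Fin n → Fin 3 := fun u => c ((u : ℤ) - a)
  obtain ⟨v, hv⟩ := hwin (col d)
  have hi : ∃ w : Fin n, (w : ℤ) - a = (v : ℤ) - a := ⟨v, rfl⟩
  have hw : hi.choose = v := Fin.ext (by have := hi.choose_spec; omega)
  refine hc ((v : ℤ) - a) (by omega) ?_
  rw [dif_pos hi, hw]
  have hdv : (d v).val < h v := by
    by_cases hva : v = a
    · subst hva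
      simpa [d, ha] using hc₀
    · rw [hother v hva]
      exact (d v).isLt
  have hlocal : s v (col fun u => if u < v then c ((v : ℤ) - a - 1) else c ((v : ℤ) - a + 1)) =
      s v (col d) := by
    refine hs v _ _ fun u hu => ?_
    have key : (if u < v then c ((v : ℤ) - a - 1) else c ((v : ℤ) - a + 1)) = d u := by
      rcases SimpleGraph.pathGraph_adj.mp hu with hu | hu
      · rw [if_neg (by rw [Fin.lt_def]; omega)]
        exact congrArg c (by omega)
      · rw [if_pos (by rw [Fin.lt_def]; omega)]
        exact congrArg c (by omega)
    simp only [col, key]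
  apply Fin.ext
  simp only [guess, Fin.val_castLE]
  rw [hlocal, hv]
  exact Nat.mod_eq_of_lt hdv
end

section
/- Let K₃ be the complete graph on three vertices (a triangle) and let h be a hatness function with h(v) ≥ 2 for each vertex v. Then the game ⟨K₃,h⟩ is winning if and only if 1/h(v₁) + 1/h(v₂) + 1/h(v₃) ≥ 1, where v₁, v₂, v₃ are the three vertices. -/
namespace HatGame

/-- A vertex guesses correctly on at most a `1 / h v` fraction of all colorings. -/
theorem card_correct_mul_le {V : Type*} [Fintype V] [DecidableEq V] {G : SimpleGraph V}
    {h : V → ℕ} (v : V) (g : (∀ u : V, Fin (h u)) → Fin (h v))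
    (hg : ∀ c c' : ∀ u : V, Fin (h u), (∀ u : V, G.Adj v u → c u = c' u) → g c = g c') :
    (Finset.univ.filter fun c : ∀ u : V, Fin (h u) => g c = c v).card * h v ≤
      Fintype.card (∀ u : V, Fin (h u)) := by
  calc _ = ((Finset.univ.filter fun c : ∀ u : V, Fin (h u) => g c = c v) ×ˢ
        (Finset.univ : Finset (Fin (h v)))).card := by simp [Finset.card_product]
    _ ≤ (Finset.univ : Finset (∀ u : V, Fin (h u))).card := by
      refine Finset.card_le_card_of_injOn (fun p => Function.update p.1 v p.2)
        (fun _ _ => Finset.mem_coe.2 (Finset.mem_univ _)) ?_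
      rintro ⟨c, x⟩ hc ⟨c', x'⟩ hc' heq
      simp only [Finset.coe_product, Set.mem_prod, Finset.mem_coe, Finset.mem_filter,
        Finset.mem_univ, true_and, and_true] at hc hc' heq
      have hx : x = x' := by simpa using congrFun heq v
      have hne : ∀ u, u ≠ v → c u = c' u := fun u hu => by
        simpa [Function.update_of_ne hu] using congrFun heq u
      have hv : c v = c' v := by
        rw [← hc, ← hc']
        exact hg c c' fun u hu => hne u hu.ne'
      refine Prod.ext (funext fun u => ?_) hx
      rcases eq_or_ne u v with rfl | hu
      exacts [hv, hne u hu]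
    _ = _ := Finset.card_univ

/-- In a winning game the reciprocals of the hatnesses sum to at least `1`. -/
theorem Winning.one_le_sum_inv {V : Type*} [Fintype V] {G : SimpleGraph V} {h : V → ℕ}
    (hpos : ∀ v, 0 < h v) (hw : Winning G h) : 1 ≤ ∑ v, (h v : ℚ)⁻¹ := by
  classical
  obtain ⟨s, hs, hwin⟩ := hw
  have : ∀ v, Nonempty (Fin (h v)) := fun v => ⟨⟨0, hpos v⟩⟩
  set A : V → Finset (∀ u : V, Fin (h u)) := fun v => Finset.univ.filter fun c => s v c = c v
  set M := Fintype.card (∀ u : V, Fin (h u)) with hM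
  have hMpos : (0 : ℚ) < M := by exact_mod_cast Fintype.card_pos
  have hcover : M ≤ ∑ v, (A v).card := by
    rw [hM, ← Finset.card_univ]
    refine (Finset.card_le_card fun c _ => ?_).trans Finset.card_biUnion_le
    obtain ⟨v, hv⟩ := hwin c
    simpa [A] using ⟨v, hv⟩
  have hbound : ∀ v, ((A v).card : ℚ) ≤ M * (h v : ℚ)⁻¹ := fun v => by
    rw [← div_eq_mul_inv, le_div_iff₀ (by exact_mod_cast hpos v)]
    exact_mod_cast card_correct_mul_le v (s v) (hs v)
  refine le_of_mul_le_mul_left ?_ hMpos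
  calc (M : ℚ) * 1 ≤ ∑ v, ((A v).card : ℚ) := by rw [mul_one]; exact_mod_cast hcover
    _ ≤ ∑ v, (M : ℚ) * (h v : ℚ)⁻¹ := Finset.sum_le_sum fun v _ => hbound v
    _ = _ := (Finset.mul_sum _ _ _).symm

/-- If `N = a v * h v` for each `v`, and the intervals `[t v, t v + a v)` cover `[0, N)`, then the
game on the complete graph is won by letting each vertex `v` guess that the residue of
`∑ u, c u * a u` modulo `N` lies in its interval. -/
theorem winning_top_of_cover {V : Type*} [Fintype V] {h : V → ℕ} (hpos : ∀ v, 0 < h v)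
    {N : ℤ} (hN : 0 < N) (a t : V → ℤ) (ha : ∀ v, 0 < a v) (hah : ∀ v, a v * h v = N)
    (hcover : ∀ r, 0 ≤ r → r < N → ∃ v, t v ≤ r ∧ r < t v + a v) :
    Winning (⊤ : SimpleGraph V) h := by
  classical
  have hpos' : ∀ v, (0 : ℤ) < h v := fun v => by exact_mod_cast hpos v
  let d : ∀ v : V, (∀ u : V, Fin (h u)) → ℤ := fun v c =>
    ∑ u ∈ Finset.univ.erase v, ((c u : ℕ) : ℤ) * a u - t v
  refine ⟨fun v c => ⟨((-(d v c / a v)) % (h v : ℤ)).toNat, ?_⟩, ?_, ?_⟩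
  · have h₁ := Int.emod_nonneg (-(d v c / a v)) (hpos' v).ne'
    have h₂ := Int.emod_lt_of_pos (-(d v c / a v)) (hpos' v)
    omega
  · intro v c c' hcc
    have hd : d v c = d v c' := by
      refine congrArg (· - t v) (Finset.sum_congr rfl fun u hu => ?_)
      rw [hcc u (by simpa using (Finset.ne_of_mem_erase hu).symm)]
    simp only [hd]
  · intro c
    set S : ℤ := ∑ u, ((c u : ℕ) : ℤ) * a u with hS
    obtain ⟨v, hv₁, hv₂⟩ := hcover (S % N) (Int.emod_nonneg _ hN.ne') (Int.emod_lt_of_pos _ hN)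
    refine ⟨v, Fin.ext ?_⟩
    have hsplit : d v c = (S % N - t v) + a v * (h v * (S / N) - (c v : ℕ)) := by
      have h₁ : ((c v : ℕ) : ℤ) * a v +
          ∑ u ∈ Finset.univ.erase v, ((c u : ℕ) : ℤ) * a u = S :=
        Finset.add_sum_erase _ (fun u => ((c u : ℕ) : ℤ) * a u) (Finset.mem_univ v)
      have h₂ := Int.emod_add_mul_ediv S N
      simp only [d]
      linear_combination h₁ - h₂ - S / N * hah v
    have hdiv : -(d v c / a v) = (c v : ℕ) + h v * (-(S / N)) := by
      rw [hsplit, Int.add_mul_ediv_left _ _ (ha v).ne',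
        Int.ediv_eq_zero_of_lt (by linarith) (by linarith)]
      ring
    have hlt : ((c v : ℕ) : ℤ) < h v := by exact_mod_cast (c v).isLt
    simp only [hdiv, Int.add_mul_emod_self_left]
    rw [Int.emod_eq_of_lt (Int.natCast_nonneg _) hlt, Int.toNat_natCast]

end HatGame

/-- The game on the triangle `K₃` with hatnesses at least 2 is winning iff the
reciprocals of the hatnesses sum to at least 1. -/
theorem triangle_winning_iff (h : Fin 3 → ℕ) (hh : ∀ v, 2 ≤ h v) :
    HatGame.Winning (⊤ : SimpleGraph (Fin 3)) h ↔
      1 ≤ (h 0 : ℚ)⁻¹ + (h 1 : ℚ)⁻¹ + (h 2 : ℚ)⁻¹ := by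
  have hpos : ∀ v, 0 < h v := fun v => two_pos.trans_le (hh v)
  refine ⟨fun hw => by simpa [Fin.sum_univ_three] using hw.one_le_sum_inv hpos, fun hsum => ?_⟩
  have p₀ : (0 : ℤ) < h 0 := by exact_mod_cast hpos 0
  have p₁ : (0 : ℤ) < h 1 := by exact_mod_cast hpos 1
  have p₂ : (0 : ℤ) < h 2 := by exact_mod_cast hpos 2
  have key : (h 0 : ℤ) * h 1 * h 2 ≤ h 1 * h 2 + h 0 * h 2 + h 0 * h 1 := by
    have q₀ : (0 : ℚ) < h 0 := by exact_mod_cast hpos 0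
    have q₁ : (0 : ℚ) < h 1 := by exact_mod_cast hpos 1
    have q₂ : (0 : ℚ) < h 2 := by exact_mod_cast hpos 2
    have hmul := mul_le_mul_of_nonneg_left hsum (mul_pos (mul_pos q₀ q₁) q₂).le
    have hexp : (h 0 : ℚ) * h 1 * h 2 * ((h 0 : ℚ)⁻¹ + (h 1 : ℚ)⁻¹ + (h 2 : ℚ)⁻¹) =
        h 1 * h 2 + h 0 * h 2 + h 0 * h 1 := by
      field_simp
    rw [mul_one, hexp] at hmul
    exact_mod_cast hmul
  refine HatGame.winning_top_of_cover hpos (mul_pos (mul_pos p₀ p₁) p₂)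
    ![(h 1 : ℤ) * h 2, h 0 * h 2, h 0 * h 1]
    ![0, (h 1 : ℤ) * h 2, h 1 * h 2 + h 0 * h 2] ?_ ?_ ?_
  · intro v
    fin_cases v
    exacts [mul_pos p₁ p₂, mul_pos p₀ p₂, mul_pos p₀ p₁]
  · intro v
    fin_cases v <;> simp <;> ring
  · intro r hr₀ hr
    rcases lt_or_ge r ((h 1 : ℤ) * h 2) with h₁ | h₁
    · exact ⟨0, by simpa using hr₀, by simpa using h₁⟩
    rcases lt_or_ge r ((h 1 : ℤ) * h 2 + h 0 * h 2) with h₂ | h₂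
    · exact ⟨1, by simpa using h₁, by simpa using h₂⟩
    · exact ⟨2, by simpa using h₂, by simpa using hr.trans_le key⟩
end

section
/- Every cactus graph containing at least one cycle contains a leaf cycle, that is, a cycle C such that after deleting the edges of C from the graph, at most one connected component of the resulting graph contains a cycle. -/
namespace SimpleGraph

variable {V : Type*} {G : SimpleGraph V}

/-- A vertex joined by a walk to a vertex of `d` remains connected to some vertex of `d` after
the edges of `d` are deleted. -/
theorem Walk.exists_mem_support_reachable_deleteEdges {a w x : V} (d : G.Walk a w)
    (p : G.Walk x w) :
    ∃ u ∈ d.support, (G.deleteEdges {e | e ∈ d.edges}).Reachable x u := by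
  induction p with
  | nil => exact ⟨_, d.end_mem_support, Reachable.refl _⟩
  | @cons x y _ h p ih =>
    by_cases he : s(x, y) ∈ d.edges
    · exact ⟨x, d.fst_mem_support_of_mem_edges he, Reachable.refl _⟩
    · obtain ⟨u, hu, hyu⟩ := ih d
      have hadj : (G.deleteEdges {e | e ∈ d.edges}).Adj x y := by
        rw [deleteEdges_adj]
        exact ⟨h, he⟩
      exact ⟨u, hu, hadj.reachable.trans hyu⟩

/-- Deleting the edges of a walk in one component of a subgraph preserves reachability in its
other components. -/
theorem Reachable.deleteEdges_of_not_reachable {H : SimpleGraph V} (hle : H ≤ G) {x y y' z : V}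
    (p : H.Walk y y') (hxz : H.Reachable x z) (hxy : ¬ H.Reachable x y) :
    (G.deleteEdges {e | e ∈ p.edges}).Reachable x z := by
  obtain ⟨q⟩ := hxz
  induction q with
  | nil => exact Reachable.refl _
  | @cons x t _ h q ih =>
    have hadj : (G.deleteEdges {e | e ∈ p.edges}).Adj x t := by
      rw [deleteEdges_adj]
      refine ⟨hle h, fun he => hxy ?_⟩
      classical
      exact ⟨(p.takeUntil x (p.fst_mem_support_of_mem_edges he)).reverse⟩
    exact hadj.reachable.trans (ih fun hty => hxy (h.reachable.trans hty))

/-- The vertices of a walk stay mutually reachable when edges outside the walk are deleted. -/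
theorem Walk.reachable_deleteEdges_of_mem_support {a b u v : V} (d : G.Walk a b)
    {s : Set (Sym2 V)} (hs : ∀ e ∈ d.edges, e ∉ s) (hu : u ∈ d.support) (hv : v ∈ d.support) :
    (G.deleteEdges s).Reachable u v := by
  classical
  have key : ∀ t ∈ d.support, (G.deleteEdges s).Reachable a t := fun t ht =>
    ⟨(d.takeUntil t ht).toDeleteEdges s fun e he => hs e (d.edges_takeUntil_subset_edges ht he)⟩
  exact (key u hu).symm.trans (key v hv)

/-- A connected finite graph with a cycle has a cycle `d` and a vertex `x` such that every cycle
avoiding the edges of `d` lies in the component of `x` once these edges are deleted. -/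
theorem Connected.exists_isCycle_forall_isCycle_reachable [Finite V] (hG : G.Connected) {v : V}
    {c : G.Walk v v} (hc : c.IsCycle) :
    ∃ (w : V) (d : G.Walk w w) (x : V), d.IsCycle ∧
      ∀ (y : V) (p : (G.deleteEdges {e | e ∈ d.edges}).Walk y y), p.IsCycle →
        (G.deleteEdges {e | e ∈ d.edges}).Reachable x y := by
  let S : Set ℕ := {n | ∃ (w : V) (d : G.Walk w w) (x : V), d.IsCycle ∧
    {z | (G.deleteEdges {e | e ∈ d.edges}).Reachable x z}.ncard = n}
  have hbdd : BddAbove S := by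
    refine ⟨Nat.card V, ?_⟩
    rintro n ⟨w, d, x, -, rfl⟩
    exact Set.ncard_le_card _
  obtain ⟨w, d, x, hd, hmax⟩ := Nat.sSup_mem (s := S) ⟨_, v, c, v, hc, rfl⟩ hbdd
  refine ⟨w, d, x, hd, fun y p hp => ?_⟩
  by_contra hxy
  have hle : G.deleteEdges {e | e ∈ d.edges} ≤ G := deleteEdges_le _
  obtain ⟨q⟩ := hG.preconnected x w
  obtain ⟨r⟩ := hG.preconnected y w
  obtain ⟨u, hu, hxu⟩ := d.exists_mem_support_reachable_deleteEdges q
  obtain ⟨t, ht, hyt⟩ := d.exists_mem_support_reachable_deleteEdges r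
  have hdp : ∀ e ∈ d.edges, e ∉ {e | e ∈ p.edges} := fun e he hep => by
    have := p.edges_subset_edgeSet hep
    rw [edgeSet_deleteEdges] at this
    exact this.2 he
  have hlt : {z | (G.deleteEdges {e | e ∈ d.edges}).Reachable x z}.ncard <
      {z | (G.deleteEdges {e | e ∈ p.edges}).Reachable x z}.ncard := by
    refine Set.ncard_lt_ncard ⟨fun z hz => Reachable.deleteEdges_of_not_reachable hle p hz hxy,
      fun hsub => hxy ?_⟩ (Set.toFinite _)
    have hxt : (G.deleteEdges {e | e ∈ p.edges}).Reachable x t :=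
      (Reachable.deleteEdges_of_not_reachable hle p hxu hxy).trans
        (d.reachable_deleteEdges_of_mem_support hdp hu ht)
    exact Reachable.trans (hsub hxt) hyt.symm
  rw [hmax] at hlt
  refine hlt.not_ge (le_csSup hbdd ⟨y, p.mapLe hle, x, hp.mapLe hle, ?_⟩)
  rw [Walk.edges_mapLe_eq_edges]

end SimpleGraph

/-- Every cactus graph containing at least one cycle contains a leaf cycle: a
cycle `d` such that after deleting the edges of `d`, at most one connected
component of the resulting graph contains a cycle. -/
theorem cactus_has_leaf_cycle {V : Type*} [Fintype V] (G : SimpleGraph V)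
    (hG : G.IsCactus) (v : V) (c : G.Walk v v) (hc : c.IsCycle) :
    ∃ (w : V) (d : G.Walk w w), d.IsCycle ∧
      {K : (G.deleteEdges {e | e ∈ d.edges}).ConnectedComponent |
        ∃ (x : V) (p : (G.deleteEdges {e | e ∈ d.edges}).Walk x x),
          p.IsCycle ∧
            (G.deleteEdges {e | e ∈ d.edges}).connectedComponentMk x = K
        }.Subsingleton := by
  obtain ⟨w, d, x, hd, h⟩ := hG.1.exists_isCycle_forall_isCycle_reachable hc
  refine ⟨w, d, hd, ?_⟩
  rintro _ ⟨y, p, hp, rfl⟩ _ ⟨z, q, hq, rfl⟩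
  exact SimpleGraph.ConnectedComponent.sound ((h y p hp).symm.trans (h z q hq))
end

section
/- For every n ≥ 3, the hat guessing number of the cycle Cₙ on n vertices satisfies HG(Cₙ) = 3 if n = 4 or n is divisible by 3, and HG(Cₙ) = 2 otherwise. -/
namespace HatGame

/-- A guessing strategy on the cycle of length `n`, unrolled along `ℕ`: vertex `k + 1` guesses
`g k a b` when its neighbors `k` and `k + 2` have colors `a` and `b`. It is winning if every
`n`-periodic coloring contains a correct guess. -/
structure IsCyclicWin {q : ℕ} (n : ℕ) (g : ℕ → Fin q → Fin q → Fin q) : Prop where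
  periodic : ∀ k, g (k + n) = g k
  exists_correct : ∀ c : ℕ → Fin q, (∀ k, c (k + n) = c k) →
    ∃ k, g k (c k) (c (k + 2)) = c (k + 1)

section Unrolling

open Fin.CommRing

theorem cycleGraph_adj_natCast_succ {m : ℕ} (k : ℕ) (u : Fin (m + 3)) :
    (SimpleGraph.cycleGraph (m + 3)).Adj ((k + 1 : ℕ) : Fin (m + 3)) u ↔
      u = (k : Fin (m + 3)) ∨ u = ((k + 2 : ℕ) : Fin (m + 3)) := by
  rw [SimpleGraph.cycleGraph_adj]
  push_cast
  constructor
  · rintro (h | h)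
    · left; linear_combination -h
    · right; linear_combination h
  · rintro (h | h)
    · left; linear_combination -h
    · right; linear_combination h

theorem natCast_add_two_ne {m : ℕ} (k : ℕ) :
    ((k + 2 : ℕ) : Fin (m + 3)) ≠ (k : Fin (m + 3)) := by
  intro h
  have h2 : ((2 : ℕ) : Fin (m + 3)) = 0 := by
    push_cast at h ⊢
    linear_combination h
  have := Nat.le_of_dvd (by norm_num) (Fin.natCast_eq_zero.mp h2)
  omega

theorem natCast_add_self {m : ℕ} (k : ℕ) :
    ((k + (m + 3) : ℕ) : Fin (m + 3)) = (k : Fin (m + 3)) := by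
  ext
  simp

theorem winning_cycleGraph_iff {n q : ℕ} (hn : 3 ≤ n) :
    Winning (SimpleGraph.cycleGraph n) (fun _ => q) ↔
      ∃ g : ℕ → Fin q → Fin q → Fin q, IsCyclicWin n g := by
  obtain ⟨m, rfl⟩ : ∃ m, n = m + 3 := ⟨n - 3, by omega⟩
  constructor
  · rintro ⟨s, hs, hwin⟩
    change Fin (m + 3) → (Fin (m + 3) → Fin q) → Fin q at s
    refine ⟨fun k a b => s ((k + 1 : ℕ) : Fin (m + 3))
      (fun u => if u = ((k + 2 : ℕ) : Fin (m + 3)) then b else a), ?_, ?_⟩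
    · intro k
      have h1 : ((k + (m + 3) + 1 : ℕ) : Fin (m + 3)) = ((k + 1 : ℕ) : Fin (m + 3)) := by
        rw [add_right_comm, natCast_add_self]
      have h2 : ((k + (m + 3) + 2 : ℕ) : Fin (m + 3)) = ((k + 2 : ℕ) : Fin (m + 3)) := by
        rw [add_right_comm, natCast_add_self]
      simp only [h1, h2]
    · intro c hc
      have hcast : ∀ k : ℕ, c ((k : Fin (m + 3)) : ℕ) = c k := fun k =>
        Function.Periodic.map_mod_nat hc k
      obtain ⟨v, hv⟩ := hwin (fun u => c u)
      obtain ⟨k, rfl⟩ : ∃ k : ℕ, v = ((k + 1 : ℕ) : Fin (m + 3)) :=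
        ⟨v + (m + 2), by rw [add_assoc, natCast_add_self, Fin.cast_val_eq_self]⟩
      refine ⟨k, ?_⟩
      rw [← hcast (k + 1), ← hv]
      refine hs _ _ _ fun u hu => ?_
      rcases (cycleGraph_adj_natCast_succ k u).mp hu with rfl | rfl
      · simp only [(natCast_add_two_ne k).symm, if_false, hcast]
      · simp only [if_true, hcast]
  · rintro ⟨g, hg⟩
    have hmod : ∀ k : ℕ, g (k % (m + 3)) = g k := fun k =>
      Function.Periodic.map_mod_nat hg.periodic k
    refine ⟨fun v c => g (v + (m + 2)) (c ((v + (m + 2) : ℕ) : Fin (m + 3)))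
      (c ((v + (m + 2) + 2 : ℕ) : Fin (m + 3))), ?_, ?_⟩
    · intro v c c' h
      have hv : v = ((v + (m + 2) + 1 : ℕ) : Fin (m + 3)) := by
        rw [add_assoc, natCast_add_self, Fin.cast_val_eq_self]
      have hadj := fun u : Fin (m + 3) => cycleGraph_adj_natCast_succ (v + (m + 2)) u
      rw [← hv] at hadj
      simp only
      rw [h _ ((hadj _).mpr (Or.inl rfl)), h _ ((hadj _).mpr (Or.inr rfl))]
    · intro c
      obtain ⟨k, hk⟩ := hg.exists_correct (fun k => c (k : Fin (m + 3)))
        (fun k => by rw [natCast_add_self])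
      refine ⟨((k + 1 : ℕ) : Fin (m + 3)), ?_⟩
      have hval : ∀ j : ℕ, ((((k + 1 : ℕ) : Fin (m + 3)) : ℕ) + j) % (m + 3) =
          (k + 1 + j) % (m + 3) := fun j => by
        rw [Fin.val_natCast, Nat.mod_add_mod]
      have hcast : ∀ a b : ℕ, a % (m + 3) = b % (m + 3) → (a : Fin (m + 3)) = (b : Fin (m + 3)) :=
        fun a b h => Fin.ext h
      have h0 : ((((k + 1 : ℕ) : Fin (m + 3)) : ℕ) + (m + 2)) % (m + 3) = k % (m + 3) := by
        rw [hval, show k + 1 + (m + 2) = k + (m + 3) by ring, Nat.add_mod_right]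
      have h2 : ((((k + 1 : ℕ) : Fin (m + 3)) : ℕ) + (m + 2) + 2) % (m + 3) =
          (k + 2) % (m + 3) := by
        rw [Nat.add_mod, h0, ← Nat.add_mod]
      change g _ _ _ = _
      rw [← hmod, h0, hmod, hcast _ _ h0, hcast _ _ h2]
      exact hk

end Unrolling

/-- The set of possible colors at the current vertex, given the color `z` of the next vertex, when
the current vertex guesses by `f` incorrectly and `A b` is the set of possible colors of the
previous vertex given the color `b` of the current one. -/
def step {q : ℕ} (f : Fin q → Fin q → Fin q) (A : Fin q → Finset (Fin q)) (z : Fin q) :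
    Finset (Fin q) :=
  {b | ∃ a ∈ A b, f a z ≠ b}

/-- The result of `m` applications of `step`, using the guessing functions `g k, g (k + 1), …`. -/
def run {q : ℕ} (g : ℕ → Fin q → Fin q → Fin q) (k : ℕ) (A : Fin q → Finset (Fin q)) :
    ℕ → Fin q → Finset (Fin q)
  | 0 => A
  | m + 1 => step (g (k + m)) (run g k A m)

/-- The state in which the previous vertex has color `y` and the current color lies in `Z`. -/
def listState {q : ℕ} (y : Fin q) (Z : Finset (Fin q)) (z : Fin q) : Finset (Fin q) :=
  if z ∈ Z then {y} else ∅

section Run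

variable {q n : ℕ} {g : ℕ → Fin q → Fin q → Fin q}

theorem mem_step {f : Fin q → Fin q → Fin q} {A : Fin q → Finset (Fin q)} {b z : Fin q} :
    b ∈ step f A z ↔ ∃ a ∈ A b, f a z ≠ b := by
  simp [step]

theorem mem_listState {y a z : Fin q} {Z : Finset (Fin q)} :
    a ∈ listState y Z z ↔ a = y ∧ z ∈ Z := by
  unfold listState
  split_ifs with h <;> simp [h]

theorem step_listState_singleton (f : Fin q → Fin q → Fin q) (x y : Fin q) :
    step f (listState x {y}) = listState y {z | f x z ≠ y} := by
  ext z b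
  simp only [mem_step, mem_listState, Finset.mem_singleton, Finset.mem_filter, Finset.mem_univ,
    true_and]
  constructor
  · rintro ⟨a, ⟨rfl, rfl⟩, h⟩
    exact ⟨rfl, h⟩
  · rintro ⟨rfl, h⟩
    exact ⟨x, ⟨rfl, rfl⟩, h⟩

theorem run_succ' (k : ℕ) (A : Fin q → Finset (Fin q)) (m : ℕ) :
    run g k A (m + 1) = run g (k + 1) (step (g k) A) m := by
  induction m with
  | zero => rfl
  | succ m ih => rw [run, ih, run, add_right_comm, add_assoc]

theorem run_one_listState_singleton (k : ℕ) (x y : Fin q) (m : ℕ) :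
    run g k (listState x {y}) (m + 1) = run g (k + 1) (listState y {z | g k x z ≠ y}) m := by
  rw [run_succ', step_listState_singleton]

theorem mem_run_succ {k m : ℕ} {A : Fin q → Finset (Fin q)} {a b z : Fin q}
    (h : a ∈ run g k A m b) (hz : g (k + m) a z ≠ b) : b ∈ run g k A (m + 1) z :=
  mem_step.mpr ⟨a, h, hz⟩

theorem mem_run_of_walk {k : ℕ} {d : ℕ → Fin q}
    (hd : ∀ m, g (k + m) (d m) (d (m + 2)) ≠ d (m + 1)) (m : ℕ) :
    d m ∈ run g k (listState (d 0) {d 1}) m (d (m + 1)) := by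
  induction m with
  | zero => simp [run, mem_listState]
  | succ m ih => exact mem_run_succ ih (hd m)

theorem exists_walk_of_mem_run {k m : ℕ} {x y a b : Fin q}
    (h : a ∈ run g k (listState x {y}) m b) :
    ∃ d : ℕ → Fin q, d 0 = x ∧ d 1 = y ∧ d m = a ∧ d (m + 1) = b ∧
      ∀ j < m, g (k + j) (d j) (d (j + 2)) ≠ d (j + 1) := by
  induction m generalizing a b with
  | zero =>
    rw [run, mem_listState, Finset.mem_singleton] at h
    exact ⟨fun j => if j = 0 then x else y, by simp [h]⟩
  | succ m ih =>
    obtain ⟨c, hc, hne⟩ := mem_step.mp h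
    obtain ⟨d, h0, h1, hm, hm1, hd⟩ := ih hc
    refine ⟨Function.update d (m + 2) b, ?_, ?_, ?_, ?_, ?_⟩
    · rwa [Function.update_of_ne (by omega)]
    · rwa [Function.update_of_ne (by omega)]
    · rwa [Function.update_of_ne (by omega)]
    · rw [Function.update_self]
    · intro j hj
      rw [Function.update_of_ne (by omega), Function.update_of_ne (by omega : j + 1 ≠ m + 2)]
      rcases Nat.lt_succ_iff_lt_or_eq.mp hj with hj | rfl
      · rw [Function.update_of_ne (by omega)]
        exact hd j hj
      · rw [Function.update_self, hm, hm1]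
        exact hne

theorem IsCyclicWin.not_mem_run (hg : IsCyclicWin n g) (hn : 2 ≤ n) (k : ℕ) (x y : Fin q) :
    x ∉ run g k (listState x {y}) n y := by
  intro h
  obtain ⟨d, h0, h1, hn0, hn1, hd⟩ := exists_walk_of_mem_run h
  obtain ⟨i, hi⟩ := hg.exists_correct (fun i => d ((i + k * (n - 1)) % n)) fun i => by
    rw [add_right_comm, Nat.add_mod_right]
  set j := (i + k * (n - 1)) % n with hj
  have hjn : j < n := Nat.mod_lt _ (by omega)
  have hgj : g (k + j) = g i := by
    have hmod : ∀ a : ℕ, g (a % n) = g a := fun a => Function.Periodic.map_mod_nat hg.periodic a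
    have : (k + j) % n = i % n := by
      rw [hj, Nat.add_mod_mod, show k + (i + k * (n - 1)) = i + k * (n - 1 + 1) by ring,
        Nat.sub_add_cancel (by omega), Nat.add_mul_mod_self_right]
    rw [← hmod, this, hmod]
  have hshift : ∀ a : ℕ, (i + a + k * (n - 1)) % n = (j + a) % n := fun a => by
    rw [add_right_comm, hj, Nat.mod_add_mod]
  simp only [hshift] at hi
  have hd1 : d ((j + 1) % n) = d (j + 1) := by
    rcases Nat.lt_or_ge (j + 1) n with h | h
    · rw [Nat.mod_eq_of_lt h]
    · rw [show j + 1 = n by omega, Nat.mod_self, h0, hn0]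
  have hd2 : d ((j + 2) % n) = d (j + 2) := by
    rcases Nat.lt_or_ge (j + 2) n with h | h
    · rw [Nat.mod_eq_of_lt h]
    · rcases Nat.lt_or_ge (j + 1) n with h' | h'
      · rw [show j + 2 = n by omega, Nat.mod_self, h0, hn0]
      · rw [show j + 2 = 1 + n by omega, Nat.add_mod_right, Nat.mod_eq_of_lt (by omega), h1,
          add_comm 1 n, hn1]
  rw [hd1, hd2, ← hgj] at hi
  exact hd j hjn hi

theorem IsCyclicWin.not_closed_walk (hg : IsCyclicWin n g) (hn : 2 ≤ n) {k : ℕ} {d : ℕ → Fin q}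
    (hd : ∀ m, g (k + m) (d m) (d (m + 2)) ≠ d (m + 1)) (h0 : d n = d 0)
    (h1 : d (n + 1) = d 1) : False := by
  have := mem_run_of_walk hd n
  rw [h0, h1] at this
  exact hg.not_mem_run hn k _ _ this

/-- If any two sets of a state meet, at most one color is excluded at each next step. -/
theorem card_step_of_inter {f : Fin q → Fin q → Fin q} {A : Fin q → Finset (Fin q)}
    (hA : ∀ b b', (A b ∩ A b').Nonempty) (z : Fin q) : q ≤ (step f A z).card + 1 := by
  have hle : (step f A z)ᶜ.card ≤ 1 := by
    rw [Finset.card_le_one]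
    intro b hb b' hb'
    obtain ⟨a, ha⟩ := hA b b'
    rw [Finset.mem_inter] at ha
    simp only [Finset.mem_compl, mem_step, not_exists, not_and, not_not] at hb hb'
    rw [← hb a ha.1, hb' a ha.2]
  rw [Finset.card_compl, Fintype.card_fin] at hle
  omega

theorem inter_nonempty_of_card {S T U : Finset (Fin q)} (hS : S ⊆ U) (hT : T ⊆ U)
    (h : U.card < S.card + T.card) : (S ∩ T).Nonempty := by
  rw [← Finset.card_pos]
  have := Finset.card_union_add_card_inter S T
  have := Finset.card_le_card (Finset.union_subset hS hT)
  omega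

theorem card_run_of_inter (hq : 3 ≤ q) {k : ℕ} {A : Fin q → Finset (Fin q)}
    (hA : ∀ b b', (A b ∩ A b').Nonempty) (m : ℕ) (z : Fin q) :
    q ≤ (run g k A (m + 1) z).card + 1 := by
  suffices ∀ m, ∀ b b', (run g k A m b ∩ run g k A m b').Nonempty from
    card_step_of_inter (this m) z
  intro m
  induction m with
  | zero => exact hA
  | succ m ih =>
    intro b b'
    have h1 := card_step_of_inter (f := g (k + m)) ih b
    have h2 := card_step_of_inter (f := g (k + m)) ih b'
    refine inter_nonempty_of_card (Finset.subset_univ _) (Finset.subset_univ _) ?_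
    rw [Finset.card_univ, Fintype.card_fin]
    simp only [run]
    omega

/-- If two sets of a state meet, the state never becomes empty at any color. -/
theorem run_nonempty_of_inter (hq : 3 ≤ q) {k : ℕ} {A : Fin q → Finset (Fin q)} {b b' : Fin q}
    (hbb : b ≠ b') (hA : (A b ∩ A b').Nonempty) (m : ℕ) (z : Fin q) :
    (run g k A (m + 1) z).Nonempty := by
  have key : ∀ m, (∃ b b', b ≠ b' ∧ (run g k A m b ∩ run g k A m b').Nonempty) →
      ∃ b b', b ≠ b' ∧ ∀ z, b ∈ run g k A (m + 1) z ∨ b' ∈ run g k A (m + 1) z := by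
    rintro m ⟨b, b', hne, a, ha⟩
    rw [Finset.mem_inter] at ha
    refine ⟨b, b', hne, fun z => ?_⟩
    by_contra! hcon
    simp only [run, mem_step, not_exists, not_and, not_not] at hcon
    exact hne ((hcon.1 a ha.1).symm.trans (hcon.2 a ha.2))
  have inv : ∀ m, ∃ b b', b ≠ b' ∧ (run g k A m b ∩ run g k A m b').Nonempty := by
    intro m
    induction m with
    | zero => exact ⟨b, b', hbb, hA⟩
    | succ m ih =>
      obtain ⟨b, b', -, h⟩ := key m ih
      obtain ⟨z, -, z', -, hzz, hz⟩ := Finset.exists_ne_map_eq_of_card_lt_of_maps_to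
        (s := (Finset.univ : Finset (Fin q))) (t := (Finset.univ : Finset Bool))
        (f := fun z => decide (b ∈ run g k A (m + 1) z)) (by simp; omega)
        (fun _ _ => Finset.mem_coe.mpr (Finset.mem_univ _))
      refine ⟨z, z', hzz, ?_⟩
      have hiff : b ∈ run g k A (m + 1) z ↔ b ∈ run g k A (m + 1) z' := decide_eq_decide.mp hz
      by_cases hb : b ∈ run g k A (m + 1) z
      · exact ⟨b, Finset.mem_inter.mpr ⟨hb, hiff.mp hb⟩⟩
      · exact ⟨b', Finset.mem_inter.mpr ⟨(h z).resolve_left hb,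
          (h z').resolve_left (mt hiff.mpr hb)⟩⟩
  obtain ⟨b, b', -, h⟩ := key m (inv m)
  rcases h z with h | h
  · exact ⟨b, h⟩
  · exact ⟨b', h⟩

theorem run_listState_nonempty (hq : 3 ≤ q) (k : ℕ) (y : Fin q) {Z : Finset (Fin q)}
    (hZ : 2 ≤ Z.card) (m : ℕ) (z : Fin q) : (run g k (listState y Z) (m + 1) z).Nonempty := by
  obtain ⟨b, hb, b', hb', hne⟩ := Finset.one_lt_card.mp hZ
  refine run_nonempty_of_inter hq hne ⟨y, ?_⟩ m z
  simp [mem_listState, hb, hb']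

theorem card_le_card_run_listState (hq : 3 ≤ q) (k : ℕ) (y : Fin q) (Z : Finset (Fin q)) (m : ℕ)
    (z : Fin q) : Z.card ≤ (run g k (listState y Z) (m + 1) z).card + 1 := by
  have hfirst : ∀ w, run g k (listState y Z) 1 w = Z.erase (g k y w) := by
    intro w
    ext b
    simp only [run, mem_step, mem_listState, Finset.mem_erase, add_zero]
    constructor
    · rintro ⟨a, ⟨rfl, hb⟩, h⟩
      exact ⟨h.symm, hb⟩
    · rintro ⟨h, hb⟩
      exact ⟨y, ⟨rfl, hb⟩, h.symm⟩
  have hcard : ∀ w, Z.card ≤ (run g k (listState y Z) 1 w).card + 1 := fun w => by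
    rw [hfirst]
    have := Finset.pred_card_le_card_erase (a := g k y w) (s := Z)
    omega
  have hq' : Z.card ≤ q := by simpa using Finset.card_le_univ Z
  rcases m with _ | m
  · exact hcard z
  rcases Nat.lt_or_ge Z.card 3 with h | h
  · rcases Nat.lt_or_ge Z.card 2 with h | h
    · omega
    · have := Finset.card_pos.mpr (run_listState_nonempty (g := g) hq k y h (m + 1) z)
      omega
  · refine hq'.trans ?_
    rw [run_succ']
    refine card_run_of_inter hq (fun b b' => ?_) m z
    have h1 := hcard b
    have h2 := hcard b'
    refine inter_nonempty_of_card (U := Z) ?_ ?_ ?_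
    · exact (hfirst b).trans_subset (Finset.erase_subset _ _)
    · exact (hfirst b').trans_subset (Finset.erase_subset _ _)
    · simp only [run, add_zero] at h1 h2
      omega

/-- The number of colors `z` of the next vertex for which a vertex guesses `y`, when the previous
vertex has color `x`. -/
def rowCount {q : ℕ} (f : Fin q → Fin q → Fin q) (x y : Fin q) : ℕ :=
  ({z | f x z = y} : Finset (Fin q)).card

/-- The number of colors `w` of the previous vertex for which a vertex guesses `x`, when the next
vertex has color `y`. -/
def colCount {q : ℕ} (f : Fin q → Fin q → Fin q) (x y : Fin q) : ℕ :=
  ({w | f w y = x} : Finset (Fin q)).card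

theorem sum_rowCount (f : Fin q → Fin q → Fin q) (x : Fin q) : ∑ y, rowCount f x y = q := by
  have := Finset.card_eq_sum_card_fiberwise (f := fun z => f x z)
    (s := (Finset.univ : Finset (Fin q))) (t := Finset.univ) (by simp)
  rw [Finset.card_univ, Fintype.card_fin] at this
  exact this.symm

theorem sum_colCount (f : Fin q → Fin q → Fin q) (y : Fin q) : ∑ x, colCount f x y = q := by
  have := Finset.card_eq_sum_card_fiberwise (f := fun w => f w y)
    (s := (Finset.univ : Finset (Fin q))) (t := Finset.univ) (by simp)
  rw [Finset.card_univ, Fintype.card_fin] at this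
  exact this.symm

theorem card_filter_ne_add_rowCount (f : Fin q → Fin q → Fin q) (x y : Fin q) :
    ({z | f x z ≠ y} : Finset (Fin q)).card + rowCount f x y = q := by
  have := Finset.card_filter_add_card_filter_not (s := (Finset.univ : Finset (Fin q)))
    (fun z => f x z = y)
  rw [Finset.card_univ, Fintype.card_fin] at this
  rw [add_comm] at this
  exact this

theorem IsCyclicWin.card_run_le_colCount (hg : IsCyclicWin n g) (hn : 2 ≤ n) (k : ℕ)
    (x y : Fin q) : (run g (k + 1) (listState x {y}) (n - 1) x).card ≤ colCount (g k) x y := by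
  refine Finset.card_le_card fun w hw => ?_
  rw [Finset.mem_filter]
  refine ⟨Finset.mem_univ _, ?_⟩
  by_contra hne
  have hgk : g (k + 1 + (n - 1)) = g k := by
    rw [show k + 1 + (n - 1) = k + n by omega, hg.periodic]
  have := mem_run_succ hw (z := y) (by rwa [hgk])
  rw [Nat.sub_add_cancel (by omega)] at this
  exact hg.not_mem_run hn (k + 1) x y this

theorem IsCyclicWin.le_rowCount_add_colCount (hg : IsCyclicWin n g) (hn : 3 ≤ n) (hq : 3 ≤ q)
    (k : ℕ) (x y : Fin q) : q ≤ rowCount (g (k + 1)) x y + colCount (g k) x y + 1 := by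
  have h1 := hg.card_run_le_colCount (by omega) k x y
  obtain ⟨m, rfl⟩ : ∃ m, n = m + 3 := ⟨n - 3, by omega⟩
  rw [show m + 3 - 1 = m + 1 + 1 by omega, run_one_listState_singleton] at h1
  have h2 := card_le_card_run_listState (g := g) hq (k + 1 + 1) y {z | g (k + 1) x z ≠ y} m x
  have h3 := card_filter_ne_add_rowCount (g (k + 1)) x y
  omega

theorem sum_rowCount_add_colCount (f f' : Fin q → Fin q → Fin q) :
    ∑ x, ∑ y, (rowCount f x y + colCount f' x y + 1) = 3 * (q * q) := by
  simp_rw [Finset.sum_add_distrib]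
  rw [Finset.sum_comm (f := fun x y => colCount f' x y)]
  simp_rw [sum_rowCount, sum_colCount]
  simp
  ring

theorem IsCyclicWin.le_three (hg : IsCyclicWin n g) (hn : 3 ≤ n) : q ≤ 3 := by
  by_contra! hq
  have h := sum_rowCount_add_colCount (g (0 + 1)) (g 0)
  have hle : ∑ _x : Fin q, ∑ _y : Fin q, q ≤ 3 * (q * q) := by
    rw [← h]
    exact Finset.sum_le_sum fun x _ => Finset.sum_le_sum fun y _ =>
      hg.le_rowCount_add_colCount hn (by omega) 0 x y
  simp only [Finset.sum_const, Finset.card_univ, Fintype.card_fin, smul_eq_mul] at hle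
  nlinarith [Nat.mul_pos (by omega : 0 < q) (by omega : 0 < q)]

theorem IsCyclicWin.shift (hg : IsCyclicWin n g) (hn : 2 ≤ n) (k : ℕ) :
    IsCyclicWin n (fun m => g (k + m)) where
  periodic m := by rw [← add_assoc, hg.periodic]
  exists_correct c hc := by
    by_contra! h
    exact hg.not_closed_walk hn (k := k) h (by simpa using hc 0) (by simpa [add_comm] using hc 1)

theorem IsCyclicWin.exists_pred (hg : IsCyclicWin n g) (hn : 1 ≤ n) (k : ℕ) :
    ∃ j, ∀ i, g (j + 1 + i) = g (k + i) :=
  ⟨k + (n - 1), fun i => by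
    rw [show k + (n - 1) + 1 + i = k + i + n by omega, hg.periodic]⟩

end Run

section ThreeColors

variable {n : ℕ} {g : ℕ → Fin 3 → Fin 3 → Fin 3} {f : Fin 3 → Fin 3 → Fin 3}

theorem IsCyclicWin.rowCount_add_colCount (hg : IsCyclicWin n g) (hn : 3 ≤ n) (k : ℕ)
    (x y : Fin 3) : rowCount (g (k + 1)) x y + colCount (g k) x y = 2 := by
  have hle := hg.le_rowCount_add_colCount hn le_rfl k
  have hsum := sum_rowCount_add_colCount (g (k + 1)) (g k)
  have h1 : ∑ x : Fin 3, ∑ y : Fin 3, 3 =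
      ∑ x, ∑ y, (rowCount (g (k + 1)) x y + colCount (g k) x y + 1) := by
    rw [hsum]
    simp
  have h2 := (Finset.sum_eq_sum_iff_of_le fun x _ => Finset.sum_le_sum fun y _ => hle x y).mp h1 x
    (Finset.mem_univ x)
  have h3 := (Finset.sum_eq_sum_iff_of_le fun y _ => hle x y).mp h2 y (Finset.mem_univ y)
  omega

theorem IsCyclicWin.rowCount_le_two (hg : IsCyclicWin n g) (hn : 3 ≤ n) (k : ℕ)
    (x y : Fin 3) : rowCount (g k) x y ≤ 2 := by
  obtain ⟨j, hj⟩ := hg.exists_pred (by omega) k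
  have := hg.rowCount_add_colCount hn j x y
  rw [hj 0, add_zero] at this
  omega

/-- When the previous vertex has color `x`, a vertex guessing by `f` guesses `y` unless the next
vertex has color `z`. -/
def GuessesUnless (f : Fin 3 → Fin 3 → Fin 3) (x y z : Fin 3) : Prop :=
  ∀ t, f x t = y ↔ t ≠ z

theorem guessesUnless_iff {x y z : Fin 3} :
    GuessesUnless f x y z ↔ ({t | f x t ≠ y} : Finset (Fin 3)) = {z} := by
  simp only [GuessesUnless, Finset.ext_iff, Finset.mem_filter, Finset.mem_univ, true_and,
    Finset.mem_singleton]
  exact forall_congr' fun t => by tauto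

theorem exists_guessesUnless_iff {x y : Fin 3} :
    (∃ z, GuessesUnless f x y z) ↔ rowCount f x y = 2 := by
  simp_rw [guessesUnless_iff]
  rw [← Finset.card_eq_one]
  have := card_filter_ne_add_rowCount f x y
  omega

theorem GuessesUnless.ne {x y z : Fin 3} (h : GuessesUnless f x y z) : f x z ≠ y :=
  fun hz => (h z).mp hz rfl

theorem GuessesUnless.unique {x y z y' z' : Fin 3} (h : GuessesUnless f x y z)
    (h' : GuessesUnless f x y' z') : y = y' ∧ z = z' := by
  obtain ⟨t, ht, ht'⟩ : ∃ t : Fin 3, t ≠ z ∧ t ≠ z' := by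
    clear h h'
    revert z z'
    decide
  have hy : y = y' := ((h t).mpr ht).symm.trans ((h' t).mpr ht')
  refine ⟨hy, ?_⟩
  by_contra hz
  exact h.ne (((h' z).mpr hz).trans hy.symm)

theorem IsCyclicWin.exists_next (hg : IsCyclicWin n g) (hn : 4 ≤ n) {k : ℕ} {x y z : Fin 3}
    (h : GuessesUnless (g k) x y z) : ∃ w, GuessesUnless (g (k + 1)) y z w := by
  obtain ⟨j, hj⟩ := hg.exists_pred (by omega) k
  rw [← add_zero k, ← hj 0, add_zero] at h
  rw [← hj 1]
  have h1 := hg.rowCount_add_colCount (by omega) j x y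
  have h2 := hg.rowCount_add_colCount (by omega) (j + 1) y z
  rw [exists_guessesUnless_iff.mp ⟨z, h⟩] at h1
  have h3 := hg.card_run_le_colCount (by omega) j x y
  obtain ⟨m, rfl⟩ : ∃ m, n = m + 4 := ⟨n - 4, by omega⟩
  rw [show m + 4 - 1 = m + 1 + 1 + 1 by omega, run_one_listState_singleton,
    guessesUnless_iff.mp h, run_one_listState_singleton] at h3
  have h4 := card_filter_ne_add_rowCount (g (j + 1 + 1)) y z
  rw [exists_guessesUnless_iff]
  by_contra hne
  have h5 := run_listState_nonempty (g := g) le_rfl (j + 1 + 1 + 1) z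
    (Z := {t | g (j + 1 + 1) y t ≠ z}) (by omega) m x
  rw [← Finset.card_pos] at h5
  omega

theorem IsCyclicWin.exists_guessesUnless (hg : IsCyclicWin n g) (hn : 5 ≤ n) :
    ∃ k x y z, GuessesUnless (g k) x y z := by
  by_contra! hno
  have hrow : ∀ k x y, rowCount (g k) x y = 1 := by
    have hle : ∀ k x y, rowCount (g k) x y ≤ 1 := fun k x y => by
      have h1 := hg.rowCount_le_two (by omega) k x y
      have h2 : rowCount (g k) x y ≠ 2 := fun h => by
        obtain ⟨z, hz⟩ := exists_guessesUnless_iff.mpr h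
        exact hno k x y z hz
      omega
    intro k x y
    refine (Finset.sum_eq_sum_iff_of_le fun y _ => hle k x y).mp ?_ y (Finset.mem_univ y)
    rw [sum_rowCount]
    simp
  have hcol : ∀ k x y, colCount (g k) x y = 1 := fun k x y => by
    have := hg.rowCount_add_colCount (by omega) k x y
    rw [hrow] at this
    omega
  have h1 := hg.card_run_le_colCount (by omega) 0 0 0
  obtain ⟨m, rfl⟩ : ∃ m, n = m + 5 := ⟨n - 5, by omega⟩
  rw [show m + 5 - 1 = m + 1 + 1 + 1 + 1 by omega, run_one_listState_singleton, run_succ',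
    run_succ', hcol] at h1
  set Z : Finset (Fin 3) := {z | g (0 + 1) 0 z ≠ 0} with hZ
  have hZcard : 1 < Z.card := by
    have := card_filter_ne_add_rowCount (g (0 + 1)) 0 0
    rw [hrow, ← hZ] at this
    omega
  obtain ⟨z₀, hz₀⟩ := Finset.card_pos.mp (by
    have := hrow (0 + 1) 0 0
    unfold rowCount at this
    omega : 0 < ({z | g (0 + 1) 0 z = 0} : Finset (Fin 3)).card)
  obtain ⟨b₀, hb₀⟩ := Finset.card_pos.mp (by
    have := hrow (0 + 1 + 1) 0 z₀
    unfold rowCount at this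
    omega : 0 < ({z | g (0 + 1 + 1) 0 z = z₀} : Finset (Fin 3)).card)
  simp only [Finset.mem_filter, Finset.mem_univ, true_and] at hz₀ hb₀
  obtain ⟨a, ha, a', ha', hne⟩ := Finset.one_lt_card.mp hZcard
  have hmem : ∀ a ∈ Z, a ∈ step (g (0 + 1 + 1)) (listState 0 Z) b₀ := fun a ha => by
    refine mem_step.mpr ⟨0, mem_listState.mpr ⟨rfl, ha⟩, ?_⟩
    rw [hb₀]
    rintro rfl
    exact (Finset.mem_filter.mp ha).2 hz₀
  have hall : ∀ z, b₀ ∈ step (g (0 + 1 + 1 + 1)) (step (g (0 + 1 + 1)) (listState 0 Z)) z := by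
    intro z
    by_contra hcon
    simp only [mem_step (b := b₀), not_exists, not_and, not_not] at hcon
    refine hne (Finset.card_le_one.mp (hcol (0 + 1 + 1 + 1) b₀ z).le a ?_ a' ?_)
    · simpa using hcon a (hmem a ha)
    · simpa using hcon a' (hmem a' ha')
  have h2 := card_run_of_inter (g := g) le_rfl (k := 0 + 1 + 1 + 1 + 1)
    (fun b b' => ⟨b₀, Finset.mem_inter.mpr ⟨hall b, hall b'⟩⟩) m 0
  omega

/-- A sequence of colors along which every vertex guesses correctly except for the actual next
color. -/
def IsChain (g : ℕ → Fin 3 → Fin 3 → Fin 3) (C : ℕ → Fin 3) : Prop :=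
  ∀ k, GuessesUnless (g k) (C k) (C (k + 1)) (C (k + 2))

open Classical in
theorem IsCyclicWin.exists_isChain (hg : IsCyclicWin n g) (hn : 4 ≤ n) {k : ℕ} {x y z : Fin 3}
    (h : GuessesUnless (g k) x y z) : ∃ C, IsChain (fun m => g (k + m)) C ∧ C 0 = x := by
  have hnext : ∀ m y z, ∃ w, (∃ x, GuessesUnless (g (k + m)) x y z) →
      GuessesUnless (g (k + m + 1)) y z w := by
    intro m y z
    by_cases hx : ∃ x, GuessesUnless (g (k + m)) x y z
    · obtain ⟨x, hx⟩ := hx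
      obtain ⟨w, hw⟩ := hg.exists_next hn hx
      exact ⟨w, fun _ => hw⟩
    · exact ⟨0, fun h => absurd h hx⟩
  choose next hnext using hnext
  let T : ℕ → Fin 3 × Fin 3 × Fin 3 := fun m =>
    Nat.rec (x, y, z) (fun m p => (p.2.1, p.2.2, next m p.2.1 p.2.2)) m
  have hT : ∀ m, GuessesUnless (g (k + m)) (T m).1 (T m).2.1 (T m).2.2 := by
    intro m
    induction m with
    | zero => exact h
    | succ m ih => exact hnext m _ _ ⟨_, ih⟩
  exact ⟨fun m => (T m).1, hT, rfl⟩

theorem IsChain.add_eq_of_eq {C C' : ℕ → Fin 3} (hC : IsChain g C) (hC' : IsChain g C') {k : ℕ}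
    (h : C k = C' k) (m : ℕ) : C (k + m) = C' (k + m) := by
  induction m with
  | zero => exact h
  | succ m ih =>
    have h1 := hC (k + m)
    rw [ih] at h1
    exact (h1.unique (hC' (k + m))).1

theorem IsChain.shift_period {C : ℕ → Fin 3} (hC : IsChain g C) (hg : IsCyclicWin n g) (a : ℕ) :
    IsChain g (fun k => C (k + n * a)) := by
  intro k
  have h := hC (k + n * a)
  have hp : g (k + n * a) = g k := by
    rw [mul_comm]
    exact Function.Periodic.nat_mul hg.periodic a k
  rwa [hp, add_right_comm, add_right_comm k _ 2] at h

theorem IsChain.add_period_ne {C : ℕ → Fin 3} (hC : IsChain g C) (hg : IsCyclicWin n g)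
    (hn : 2 ≤ n) (k : ℕ) : C (k + n) ≠ C k := by
  intro h
  have h' : ∀ m, C (k + m + n * 1) = C (k + m) :=
    (hC.shift_period hg 1).add_eq_of_eq hC (by simpa using h)
  refine hg.not_closed_walk hn (k := k) (d := fun m => C (k + m)) (fun m => (hC (k + m)).ne) ?_ ?_
  · simpa using h
  · have := h' 1
    rwa [mul_one, add_right_comm] at this

theorem fin_three_eq {a b c x : Fin 3} (hab : a ≠ b) (hac : a ≠ c) (hbc : b ≠ c) (hxa : x ≠ a)
    (hxb : x ≠ b) : x = c := by
  omega

theorem IsCyclicWin.eq_of_guessesUnless (hg : IsCyclicWin n g) (hn : 3 ≤ n) {k : ℕ}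
    {x x' y z z' : Fin 3} (h : GuessesUnless (g k) x y z) (h' : GuessesUnless (g k) x' y z') :
    x = x' := by
  obtain ⟨j, hj⟩ := hg.exists_pred (by omega) k
  rw [← add_zero k, ← hj 0, add_zero] at h h'
  by_contra hne
  have h1 := hg.rowCount_add_colCount hn j x y
  have h2 := hg.rowCount_add_colCount hn j x' y
  rw [exists_guessesUnless_iff.mp ⟨_, h⟩] at h1
  rw [exists_guessesUnless_iff.mp ⟨_, h'⟩] at h2
  obtain ⟨x₂, hx, hx'⟩ : ∃ x₂ : Fin 3, x ≠ x₂ ∧ x' ≠ x₂ := by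
    clear h h' h1 h2
    revert x x'
    decide
  have h3 := hg.rowCount_add_colCount hn j x₂ y
  have h4 := sum_colCount (g j) y
  rw [Fin.sum_univ_three] at h4
  have hcases : ∀ i : Fin 3, colCount (g j) i y ≤ 2 ∧ (i ≠ x₂ → colCount (g j) i y = 0) := by
    intro i
    refine ⟨by have := hg.rowCount_add_colCount hn j i y; omega, fun hi => ?_⟩
    rcases eq_or_ne i x with rfl | hix
    · omega
    · rcases eq_or_ne i x' with rfl | hix'
      · omega
      · exact absurd (fin_three_eq hne hx hx' hix hix') hi
  have h0 := hcases 0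
  have h1 := hcases 1
  have h2 := hcases 2
  fin_cases x₂ <;> simp_all

/-- Three chains pairwise disjoint: the coloring is obtained by moving to another chain at each
vertex. -/
theorem IsCyclicWin.three_dvd_of_ne {C : ℕ → Fin 3} (hg : IsCyclicWin n g) (hn : 2 ≤ n)
    (hC : IsChain g C) (h2 : ∀ k, C (k + n * 2) ≠ C k) : 3 ∣ n := by
  by_contra h3
  have h1 : ∀ k, C (k + n) ≠ C k := hC.add_period_ne hg hn
  have hthree : ∀ k, C (k + n * 3) = C k := fun k => by
    refine fin_three_eq (h1 (k + n)) ?_ (h1 k) ?_ ?_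
    · simpa [add_assoc, mul_two] using h2 k
    · simpa [add_assoc, show n * 3 = n + (n + n) by ring] using h1 (k + n + n)
    · simpa [add_assoc, show n * 3 = n + n * 2 by ring] using h2 (k + n)
  have hper : ∀ a k, C (k + n * (3 * a)) = C k := by
    intro a
    induction a with
    | zero => simp
    | succ a ih =>
      intro k
      rw [show k + n * (3 * (a + 1)) = k + n * (3 * a) + n * 3 by ring, hthree, ih]
  obtain ⟨t, s, hts, ht, ht'⟩ : ∃ t s, 1 + t * n = 3 * s ∧ (∀ k, C (k + n * t) ≠ C k) ∧
      ∀ k, C (k + n * (2 * t)) ≠ C k := by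
    rcases (by omega : n % 3 = 2 ∨ n % 3 = 1) with h | h
    · refine ⟨1, (1 + n) / 3, by omega, by simpa using h1, by simpa using h2⟩
    · refine ⟨2, (1 + 2 * n) / 3, by omega, h2, fun k => ?_⟩
      rw [show k + n * (2 * 2) = k + n + n * 3 by ring, hthree]
      exact h1 k
  refine hg.not_closed_walk hn (k := 0) (d := fun m => C (m + n * (t * m))) (fun m => ?_) ?_ ?_
  · have h := hC.shift_period hg (t * m) m
    have hgt : g (0 + m) (C (m + n * (t * m))) (C (m + 2 + n * (t * (m + 2)))) =
        C (m + 1 + n * (t * m)) := by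
      rw [zero_add]
      refine (h _).mpr ?_
      rw [show m + 2 + n * (t * (m + 2)) = m + 2 + n * (t * m) + n * (2 * t) by ring]
      exact ht' _
    rw [hgt, show m + 1 + n * (t * (m + 1)) = m + 1 + n * (t * m) + n * t by ring]
    exact (ht _).symm
  · rw [show n + n * (t * n) = 0 + n * (1 + t * n) by ring, hts, hper]
    simp
  · rw [show n + 1 + n * (t * (n + 1)) = 1 + n * (t * 1) + n * (1 + t * n) by ring, hts, hper]

theorem IsCyclicWin.false_of_eq {C : ℕ → Fin 3} (hg : IsCyclicWin n g) (hn : 5 ≤ n)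
    (hC : IsChain g C) (h2 : C (0 + n * 2) = C 0) : False := by
  have hn3 : 3 ≤ n := by omega
  have h1 : ∀ k, C (k + n) ≠ C k := hC.add_period_ne hg (by omega)
  have hper : ∀ k, C (k + n * 2) = C k := fun k => by
    simpa using (hC.shift_period hg 2).add_eq_of_eq hC h2 k
  have hC' : IsChain g (fun k => C (k + n)) := by simpa using hC.shift_period hg 1
  have hthird : ∀ k, ∃ e, e ≠ C k ∧ e ≠ C (k + n) := fun k => by
    have : ∀ a b : Fin 3, ∃ e, e ≠ a ∧ e ≠ b := by decide
    exact this _ _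
  choose e he he' using hthird
  have heq : ∀ k x, x ≠ C k → x ≠ C (k + n) → x = e k := fun k x hx hx' =>
    fin_three_eq (h1 k).symm (he k).symm (he' k).symm hx hx'
  have hcases : ∀ k x, x ≠ e k → x = C k ∨ x = C (k + n) := fun k x hx => by
    by_contra! h
    exact hx (heq k x h.1 h.2)
  have heper : ∀ k, e (k + n) = e k := fun k => by
    refine heq k _ ?_ (he (k + n))
    have := he' (k + n)
    rwa [add_assoc, ← mul_two, hper] at this
  have hfree : ∀ k y z, ¬ GuessesUnless (g k) (e k) y z := by
    intro k y z h
    obtain ⟨E, hE, hE0⟩ := hg.exists_isChain (by omega) h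
    have hEe : ∀ m, E m = e (k + m) := by
      intro m
      induction m with
      | zero => exact hE0
      | succ m ih =>
        have hm := hE m
        refine heq _ _ (fun hcon => ?_) (fun hcon => ?_)
        · rw [hcon] at hm
          have := hg.eq_of_guessesUnless hn3 hm (hC (k + m))
          exact he (k + m) (ih.symm.trans this)
        · rw [hcon] at hm
          have := hg.eq_of_guessesUnless hn3 hm (hC' (k + m))
          exact he' (k + m) (ih.symm.trans this)
    refine hE.add_period_ne (hg.shift (by omega) k) (by omega) 0 ?_
    rw [zero_add, hEe, hEe, heper, add_zero]
  have hrow : ∀ k y, rowCount (g k) (e k) y ≤ 1 := fun k y => by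
    have hle := hg.rowCount_le_two hn3 k (e k) y
    have hne : rowCount (g k) (e k) y ≠ 2 := fun h => by
      obtain ⟨z, hz⟩ := exists_guessesUnless_iff.mpr h
      exact hfree k y z hz
    omega
  have hsee : ∀ k s, s ≠ e k → g k s (e (k + 2)) ≠ e (k + 1) := by
    intro k s hs
    rcases hcases k s hs with rfl | rfl
    · rw [(hC k _).mpr (he _)]
      exact (he _).symm
    · have := (hC' k _).mpr (he' (k + 2))
      simp only at this
      rw [this]
      exact (he' _).symm
  have hses : ∀ k s, s ≠ e k → ∃ s', s' ≠ e (k + 2) ∧ g k s s' ≠ e (k + 1) := by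
    intro k s hs
    rcases hcases k s hs with rfl | rfl
    · refine ⟨C (k + 2 + n), (he' _).symm, ?_⟩
      rw [(hC k _).mpr (h1 _)]
      exact (he _).symm
    · refine ⟨C (k + 2), (he _).symm, ?_⟩
      have := (hC' k _).mpr (h1 (k + 2)).symm
      simp only at this
      rw [this]
      exact (he' _).symm
  have heee : ∀ k, g k (e k) (e (k + 2)) = e (k + 1) := by
    intro k
    have h3 := hg.rowCount_add_colCount hn3 k (e (k + 1)) (e (k + 1 + 1))
    have h4 := hrow (k + 1) (e (k + 1 + 1))
    obtain ⟨w, hw⟩ := Finset.card_pos.mp (show 0 < colCount (g k) (e (k + 1)) (e (k + 1 + 1)) by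
      omega)
    rw [Finset.mem_filter] at hw
    by_contra hne
    refine hsee k w (fun h => ?_) hw.2
    rw [h] at hw
    exact hne hw.2
  have hees : ∀ k s, s ≠ e (k + 2) → g k (e k) s ≠ e (k + 1) := by
    intro k s hs h
    exact hs (Finset.card_le_one.mp (hrow k (e (k + 1))) s (by simpa using h) _
      (by simpa using heee k))
  have hese : ∀ k s, s ≠ e (k + 1) → g k (e k) (e (k + 2)) ≠ s := fun k s hs => by
    rw [heee]
    exact hs.symm
  let P : ℕ → Fin 3 → Prop := fun m s => s ∈ run g 0 (listState (C 0) {e 1}) m (e (m + 1))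
  have hstart : P 0 (C 0) := by simp [P, run, mem_listState]
  have htwo : ∀ m s, s ≠ e m → P m s → ∃ s', s' ≠ e (m + 2) ∧ P (m + 2) s' := by
    intro m s hs hP
    obtain ⟨s', hs', h⟩ := hses m s hs
    refine ⟨s', hs', mem_run_succ (mem_run_succ hP ?_) ?_⟩
    · rwa [zero_add]
    · rw [zero_add]
      exact hese (m + 1) s' hs'
  have hthree : ∀ m s, s ≠ e m → P m s → ∀ s', s' ≠ e (m + 3) → P (m + 3) s' := by
    intro m s hs hP s' hs'
    refine mem_run_succ (mem_run_succ (mem_run_succ hP (z := e (m + 2)) ?_) ?_) ?_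
    · rw [zero_add]
      exact hsee m s hs
    · rw [zero_add]
      exact hees (m + 1) s' hs'
    · rw [zero_add]
      exact hese (m + 2) s' hs'
  have hiter : ∀ a, ∃ s, s ≠ e (2 * a) ∧ P (2 * a) s := by
    intro a
    induction a with
    | zero => exact ⟨C 0, (he 0).symm, hstart⟩
    | succ a ih =>
      obtain ⟨s, hs, hP⟩ := ih
      exact htwo _ s hs hP
  have hend : P n (C 0) := by
    have hC0 : C 0 ≠ e n := by
      have := heper 0
      rw [zero_add] at this
      rw [this]
      exact (he 0).symm
    obtain ⟨a, ha | ha⟩ : ∃ a, n = 2 * a + 3 ∨ n = 2 * a + 3 + 3 := by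
      rcases Nat.even_or_odd' n with ⟨b, hb | hb⟩
      · exact ⟨b - 3, by omega⟩
      · exact ⟨b - 1, by omega⟩
    · obtain ⟨s, hs, hP⟩ := hiter a
      rw [ha] at hC0 ⊢
      exact hthree _ s hs hP _ hC0
    · obtain ⟨s, hs, hP⟩ := hiter a
      rw [ha] at hC0 ⊢
      exact hthree _ _ (he (2 * a + 3)).symm (hthree _ s hs hP _ (he _).symm) _ hC0
  refine hg.not_mem_run (by omega) 0 (C 0) (e 1) ?_
  have h3 : C 0 ∈ run g 0 (listState (C 0) {e 1}) n (e (n + 1)) := hend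
  rwa [add_comm n 1, heper] at h3

theorem IsCyclicWin.three_dvd (hg : IsCyclicWin n g) (hn : 5 ≤ n) : 3 ∣ n := by
  obtain ⟨k, x, y, z, h⟩ := hg.exists_guessesUnless hn
  obtain ⟨C, hC, -⟩ := hg.exists_isChain (by omega) h
  have hgk := hg.shift (by omega) k
  by_contra h3
  have hne : ¬ ∀ j, C (j + n * 2) ≠ C j := fun h2 => h3 (hgk.three_dvd_of_ne (by omega) hC h2)
  push Not at hne
  obtain ⟨j, hj⟩ := hne
  refine (hgk.shift (by omega) j).false_of_eq hn (C := fun m => C (j + m)) (fun m => hC (j + m)) ?_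
  simpa using hj

open Fin.CommRing in
/-- The guessing strategy on a cycle of length divisible by three. A vertex guesses the color of
its predecessor, or the next color (cyclically) when both neighbors have the same color; colors
are shifted by one every time the cycle is traversed. -/
theorem exists_isCyclicWin_of_three_dvd (hn : 3 ≤ n) (h3 : 3 ∣ n) :
    ∃ g : ℕ → Fin 3 → Fin 3 → Fin 3, IsCyclicWin n g := by
  obtain ⟨G, hG⟩ : ∃ G : Fin 3 → Fin 3 → Fin 3, ∀ a b, G a b = if a = b then a + 1 else a :=
    ⟨_, fun _ _ => rfl⟩
  have hGadd : ∀ a b, G (a + 1) (b + 1) = G a b + 1 := by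
    simp only [hG]
    decide
  have hGzero : ∀ a z, G a z ≠ a → z = a := by
    simp only [hG]
    decide
  have hGone : ∀ a z, G a z ≠ a + 1 → z ≠ a + 1 → z = a + 1 + 1 := by
    simp only [hG]
    decide
  have hdiv : ∀ k, (((k + n) / n : ℕ) : Fin 3) = ((k / n : ℕ) : Fin 3) + 1 := fun k => by
    rw [Nat.add_div_right k (by omega)]
    push_cast
    ring
  have hn0 : (n : Fin 3) = 0 := Fin.natCast_eq_zero.mpr h3
  refine ⟨fun k a b => G (a + (k / n : ℕ)) (b + ((k + 2) / n : ℕ)) - ((k + 1) / n : ℕ), ?_, ?_⟩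
  · intro k
    funext a b
    rw [add_right_comm k n 2, add_right_comm k n 1, hdiv, hdiv, hdiv, ← add_assoc, ← add_assoc,
      hGadd]
    ring
  · intro c hc
    by_contra! hwrong
    set d : ℕ → Fin 3 := fun k => c k + (k / n : ℕ) with hd
    have hstep : ∀ k, G (d k) (d (k + 2)) ≠ d (k + 1) := fun k h =>
      hwrong k (sub_eq_of_eq_add h)
    have hdn : ∀ k, d (k + n) ≠ d k := fun k h => by
      have h' : d (k + n) = d k + 1 := by
        simp only [hd, hdiv, hc]
        ring
      rw [h'] at h
      simp at h
    have hlin : ∀ k (r : Fin 3), ¬ ∀ m, d (k + m + 1) = d (k + m) + r := by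
      intro k r h
      have : ∀ m : ℕ, d (k + m) = d k + m * r := by
        intro m
        induction m with
        | zero => simp
        | succ m ih =>
          rw [← add_assoc, h, ih]
          push_cast
          ring
      exact hdn k (by rw [this n, hn0]; ring)
    have hzero : ∀ k, d (k + 1) ≠ d k := by
      intro k h
      refine hlin k 0 fun m => ?_
      rw [add_zero]
      induction m with
      | zero => exact h
      | succ m ih =>
        have := hstep (k + m)
        rw [ih] at this
        exact (hGzero _ _ this).trans ih.symm
    have hone : ∀ k, d (k + 1) ≠ d k + 1 := by
      intro k h
      refine hlin k 1 fun m => ?_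
      induction m with
      | zero => exact h
      | succ m ih =>
        have h1 := hstep (k + m)
        have h2 := hzero (k + m + 1)
        rw [ih] at h1 h2
        exact (hGone _ _ h1 h2).trans (by rw [← add_assoc k m 1, ih])
    refine hlin 0 2 fun m => ?_
    have : ∀ a b : Fin 3, b ≠ a → b ≠ a + 1 → b = a + 2 := by decide
    exact this _ _ (hzero _) (hone _)

end ThreeColors

theorem winning_cycleGraph_four_three : Winning (SimpleGraph.cycleGraph 4) (fun _ => 3) := by
  let s : Fin 4 → (Fin 4 → Fin 3) → Fin 3 := fun v c =>
    ![c 3 + c 1, 2 * c 0 + c 2, 2 * c 1 + c 3, 2 * c 2 + 2 * c 0] v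
  refine ⟨s, fun v c c' h => ?_, ?_⟩
  · fin_cases v
    · simp [s, h 1 (by decide), h 3 (by decide)]
    · simp [s, h 0 (by decide), h 2 (by decide)]
    · simp [s, h 1 (by decide), h 3 (by decide)]
    · simp [s, h 0 (by decide), h 2 (by decide)]
  · change ∀ c : Fin 4 → Fin 3, ∃ v, s v c = c v
    have key : ∀ a b c d : Fin 3,
        d + b = a ∨ 2 * a + c = b ∨ 2 * b + d = c ∨ 2 * c + 2 * a = d := by
      decide
    intro c
    rcases key (c 0) (c 1) (c 2) (c 3) with h | h | h | h
    · exact ⟨0, h⟩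
    · exact ⟨1, h⟩
    · exact ⟨2, h⟩
    · exact ⟨3, h⟩

theorem winning_cycleGraph_two {n : ℕ} (hn : 3 ≤ n) :
    Winning (SimpleGraph.cycleGraph n) (fun _ => 2) := by
  obtain ⟨m, rfl⟩ : ∃ m, n = m + 3 := ⟨n - 3, by omega⟩
  let s : Fin (m + 3) → (Fin (m + 3) → Fin 2) → Fin 2 := fun v c =>
    if v = 0 then c 1 else if v = 1 then c 0 + 1 else 0
  refine ⟨s, fun v c c' h => ?_, ?_⟩
  · by_cases h0 : v = 0
    · subst h0
      simp [s, h 1 (by simp [SimpleGraph.cycleGraph_adj])]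
    · by_cases h1 : v = 1
      · subst h1
        simp [s, h 0 (by simp [SimpleGraph.cycleGraph_adj])]
      · simp [s, h0, h1]
  · change ∀ c : Fin (m + 3) → Fin 2, ∃ v, s v c = c v
    intro c
    have key : ∀ a b : Fin 2, b = a ∨ a + 1 = b := by decide
    rcases key (c 0) (c 1) with h | h
    · exact ⟨0, by simpa [s] using h⟩
    · exact ⟨1, by simpa [s] using h⟩

theorem winning_cycleGraph_three_iff {n : ℕ} (hn : 3 ≤ n) :
    Winning (SimpleGraph.cycleGraph n) (fun _ => 3) ↔ n = 4 ∨ 3 ∣ n := by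
  constructor
  · intro h
    obtain ⟨g, hg⟩ := (winning_cycleGraph_iff hn).mp h
    rcases (by omega : n = 3 ∨ n = 4 ∨ 5 ≤ n) with rfl | h4 | h5
    · exact Or.inr dvd_rfl
    · exact Or.inl h4
    · exact Or.inr (hg.three_dvd h5)
  · rintro (rfl | h3)
    · exact winning_cycleGraph_four_three
    · exact (winning_cycleGraph_iff hn).mpr (exists_isCyclicWin_of_three_dvd hn h3)

theorem le_three_of_winning_cycleGraph {n q : ℕ} (hn : 3 ≤ n)
    (h : Winning (SimpleGraph.cycleGraph n) (fun _ => q)) : q ≤ 3 := by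
  obtain ⟨g, hg⟩ := (winning_cycleGraph_iff hn).mp h
  exact hg.le_three hn

end HatGame

/-- The hat guessing number of the cycle on `n ≥ 3` vertices is 3 if `n = 4` or
`3 ∣ n`, and 2 otherwise. -/
theorem hgNumber_cycleGraph (n : ℕ) [NeZero n] (hn : 3 ≤ n) :
    HatGame.number (SimpleGraph.cycleGraph n) =
      if n = 4 ∨ 3 ∣ n then 3 else 2 := by
  apply IsGreatest.csSup_eq
  split_ifs with h
  · exact ⟨(HatGame.winning_cycleGraph_three_iff hn).mpr h,
      fun q hq => HatGame.le_three_of_winning_cycleGraph hn hq⟩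
  · refine ⟨HatGame.winning_cycleGraph_two hn, fun q hq => ?_⟩
    have hle := HatGame.le_three_of_winning_cycleGraph hn hq
    have hne : q ≠ 3 := by
      rintro rfl
      exact h ((HatGame.winning_cycleGraph_three_iff hn).mp hq)
    omega
end
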